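/- There exists a positive bounded linear operator T on c₀ such that ‖T^n‖ ≤ 4 for every n ≥ 1, every power T^m (m ≥ 1) is mean ergodic, and T is not weakly almost periodic: there exists x ∈ c₀ whose orbit {T^n x : n ∈ ℕ} is not relatively compact in the weak topology. -/

import Mathlib

open Filter ZeroAtInftyContinuousMap
open scoped ZeroAtInfty

namespace NullSequence

lemma tendsto_cofinite_zero_iff {ι : Type*} {y : ι → ℝ} :
    Tendsto y cofinite (nhds 0) ↔ ∀ ε > 0, {p | ε ≤ |y p|}.Finite := by
  rw [Metric.tendsto_nhds]
  simp [Filter.eventually_cofinite]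

lemma abs_apply_le_norm (x : C₀(ℕ, ℝ)) (p : ℕ) : |x p| ≤ ‖x‖ := by
  rw [← norm_toBCF_eq_norm]
  exact x.toBCF.norm_coe_le_norm p

lemma norm_le_of_forall_abs_le {x : C₀(ℕ, ℝ)} {C : ℝ} (hC : 0 ≤ C) (h : ∀ p, |x p| ≤ C) :
    ‖x‖ ≤ C := by
  rw [← norm_toBCF_eq_norm]
  exact (BoundedContinuousFunction.norm_le hC).2 h

lemma finite_le_abs (x : C₀(ℕ, ℝ)) {ε : ℝ} (hε : 0 < ε) : {p | ε ≤ |x p|}.Finite := by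
  have h := x.zero_at_infty'
  rw [cocompact_eq_cofinite] at h
  exact tendsto_cofinite_zero_iff.1 h ε hε

/-- The null sequence with the given values. -/
def ofTendsto (f : ℕ → ℝ) (hf : Tendsto f cofinite (nhds 0)) : C₀(ℕ, ℝ) :=
  ⟨⟨f, continuous_of_discreteTopology⟩, by rwa [cocompact_eq_cofinite]⟩

@[simp] lemma ofTendsto_apply (f : ℕ → ℝ) (hf) (p : ℕ) : ofTendsto f hf p = f p := rfl

/-- The `p`-th unit vector. -/
def unit (p : ℕ) : C₀(ℕ, ℝ) :=
  ofTendsto (fun q => if q = p then 1 else 0) <| tendsto_cofinite_zero_iff.2 fun ε hε =>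
    (Set.finite_singleton p).subset fun q hq => by
      by_contra h
      have hqp : q ≠ p := h
      simp only [Set.mem_ofPred_eq, if_neg hqp, abs_zero] at hq
      linarith

lemma unit_apply (p q : ℕ) : unit p q = if q = p then 1 else 0 := rfl

/-- Evaluation at `p`. -/
noncomputable def coord (p : ℕ) : C₀(ℕ, ℝ) →L[ℝ] ℝ :=
  LinearMap.mkContinuous ⟨⟨fun x => x p, fun _ _ => rfl⟩, fun _ _ => rfl⟩ 1 fun x => by
    simpa using abs_apply_le_norm x p

@[simp] lemma coord_apply (p : ℕ) (x : C₀(ℕ, ℝ)) : coord p x = x p := rfl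

lemma finset_sum_apply {ι : Type*} (s : Finset ι) (f : ι → C₀(ℕ, ℝ)) (p : ℕ) :
    (∑ i ∈ s, f i) p = ∑ i ∈ s, f i p :=
  map_sum (coord p) f s

lemma exists_norm_sub_sum_unit_le (x : C₀(ℕ, ℝ)) {ε : ℝ} (hε : 0 < ε) :
    ∃ F : Finset ℕ, ‖x - ∑ p ∈ F, x p • unit p‖ ≤ ε := by
  refine ⟨(finite_le_abs x hε).toFinset, norm_le_of_forall_abs_le hε.le fun q => ?_⟩
  simp only [ZeroAtInftyContinuousMap.sub_apply, finset_sum_apply,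
    ZeroAtInftyContinuousMap.smul_apply, unit_apply, smul_eq_mul, mul_ite, mul_one,
    mul_zero, Finset.sum_ite_eq, Set.Finite.mem_toFinset, Set.mem_ofPred_eq]
  split_ifs with h
  · simpa using hε.le
  · simpa using (not_le.1 h).le

/-- The Cesàro means of a power-bounded operator on `c₀` tend to zero everywhere as soon as they do
so on the unit vectors. -/
lemma tendsto_cesaro_zero {S : C₀(ℕ, ℝ) →L[ℝ] C₀(ℕ, ℝ)} {C : ℝ} (hS : ∀ k, ‖S ^ k‖ ≤ C)
    (h : ∀ p, Tendsto (fun n : ℕ => (n : ℝ)⁻¹ • ∑ k ∈ Finset.range n, (S ^ k) (unit p))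
      atTop (nhds 0)) (x : C₀(ℕ, ℝ)) :
    Tendsto (fun n : ℕ => (n : ℝ)⁻¹ • ∑ k ∈ Finset.range n, (S ^ k) x) atTop (nhds 0) := by
  have hC : 0 ≤ C := (norm_nonneg (S ^ 0)).trans (hS 0)
  have hbound (n : ℕ) (z : C₀(ℕ, ℝ)) :
      ‖(n : ℝ)⁻¹ • ∑ k ∈ Finset.range n, (S ^ k) z‖ ≤ C * ‖z‖ := by
    have h1 : ‖∑ k ∈ Finset.range n, (S ^ k) z‖ ≤ n * (C * ‖z‖) := by
      refine (norm_sum_le_of_le _ fun k _ => (S ^ k).le_of_opNorm_le (hS k) z).trans ?_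
      simp
    rw [norm_smul, norm_inv, Real.norm_natCast]
    rcases Nat.eq_zero_or_pos n with rfl | hn
    · simpa using mul_nonneg hC (norm_nonneg z)
    · rw [inv_mul_le_iff₀ (by exact_mod_cast hn)]
      exact h1
  rw [Metric.tendsto_nhds]
  intro ε hε
  obtain ⟨F, hF⟩ := exists_norm_sub_sum_unit_le x (ε := ε / (2 * (C + 1))) (by positivity)
  set y := ∑ p ∈ F, x p • unit p with hy
  have hlim : Tendsto (fun n : ℕ => (n : ℝ)⁻¹ • ∑ k ∈ Finset.range n, (S ^ k) y)
      atTop (nhds 0) := by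
    have h1 := tendsto_finsetSum F fun p _ => (h p).const_smul (x p)
    simp only [smul_zero, Finset.sum_const_zero] at h1
    refine h1.congr fun n => ?_
    simp only [hy, map_sum, map_smul]
    rw [Finset.sum_comm, Finset.smul_sum]
    refine Finset.sum_congr rfl fun p _ => ?_
    rw [← Finset.smul_sum, smul_comm]
  filter_upwards [Metric.tendsto_nhds.1 hlim (ε / 2) (by positivity)] with n hn
  rw [dist_zero_right] at hn ⊢
  have hsplit : (n : ℝ)⁻¹ • ∑ k ∈ Finset.range n, (S ^ k) x =
      (n : ℝ)⁻¹ • ∑ k ∈ Finset.range n, (S ^ k) (x - y) +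
        (n : ℝ)⁻¹ • ∑ k ∈ Finset.range n, (S ^ k) y := by
    have hsum : ∑ k ∈ Finset.range n, (S ^ k) x =
        ∑ k ∈ Finset.range n, (S ^ k) (x - y) + ∑ k ∈ Finset.range n, (S ^ k) y := by
      simp only [map_sub, Finset.sum_sub_distrib]
      exact (sub_add_cancel _ _).symm
    rw [hsum]
    exact smul_add (n : ℝ)⁻¹ (_ : C₀(ℕ, ℝ)) _
  have hsmall : C * ‖x - y‖ ≤ ε / 2 := by
    refine (mul_le_mul_of_nonneg_left hF hC).trans ?_
    rw [← mul_div_assoc, div_le_div_iff₀ (by positivity) (by positivity)]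
    nlinarith
  rw [hsplit]
  linarith [norm_add_le ((n : ℝ)⁻¹ • ∑ k ∈ Finset.range n, (S ^ k) (x - y))
    ((n : ℝ)⁻¹ • ∑ k ∈ Finset.range n, (S ^ k) y), hbound n (x - y)]

lemma tendsto_natLog_div_atTop {c : ℕ} (hc : 1 ≤ c) (d : ℕ) :
    Tendsto (fun n : ℕ => (n : ℝ)⁻¹ * (Nat.log 2 (c * n + d) + 1)) atTop (nhds 0) := by
  have h0 : Tendsto (fun n : ℕ => ((c * n + d : ℕ) : ℝ)) atTop atTop :=
    tendsto_natCast_atTop_atTop.comp <|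
      tendsto_atTop_mono (fun n => show n ≤ c * n + d by nlinarith) tendsto_id
  have h1 : Tendsto (fun n : ℕ => Real.log (c * n + d : ℕ) / (c * n + d : ℕ)) atTop (nhds 0) :=
    Real.isLittleO_log_id_atTop.tendsto_div_nhds_zero.comp h0
  have hinv : Tendsto (fun n : ℕ => (n : ℝ)⁻¹) atTop (nhds 0) := tendsto_inv_atTop_nhds_zero_nat
  have h2 : Tendsto (fun n : ℕ => (c + d * (n : ℝ)⁻¹) / Real.log 2 *
      (Real.log (c * n + d : ℕ) / (c * n + d : ℕ)) + (n : ℝ)⁻¹) atTop (nhds 0) := by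
    simpa using ((((hinv.const_mul (d : ℝ)).const_add (c : ℝ)).div_const (Real.log 2)).mul h1).add
      hinv
  refine tendsto_of_tendsto_of_tendsto_of_le_of_le' tendsto_const_nhds h2
    (Eventually.of_forall fun n => by positivity) ?_
  filter_upwards [eventually_ge_atTop 1] with n hn
  have hn' : (0 : ℝ) < n := by exact_mod_cast hn
  have hpos : (0 : ℝ) < (c * n + d : ℕ) := by
    have : 0 < c * n + d := by positivity
    exact_mod_cast this
  have h3 := Real.natLog_le_logb (c * n + d) 2
  rw [Real.logb, Nat.cast_ofNat] at h3
  have hlog : 0 < Real.log 2 := Real.log_pos one_lt_two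
  calc (n : ℝ)⁻¹ * (Nat.log 2 (c * n + d) + 1)
      ≤ (n : ℝ)⁻¹ * (Real.log (c * n + d : ℕ) / Real.log 2 + 1) := by gcongr
    _ = _ := by
      push_cast at hpos ⊢
      field_simp

/-- An enumeration of the states: `Sum.inl s` is a point `s` steps before absorption, and
`Sum.inr (j, m)` is the point at position `m` on the `j`-th line. -/
def code : ℕ ⊕ ℕ × ℕ ≃ ℕ := Denumerable.eqv _

open Classical in
/-- The transition rule. Points of the form `Sum.inl s` move towards absorption. Points on the
`j`-th line move along it, and at each position `m ≥ j` which is a power of two they send an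
additional unit mass to `Sum.inl (m - 1)`. -/
noncomputable def step (y : ℕ ⊕ ℕ × ℕ → ℝ) : ℕ ⊕ ℕ × ℕ → ℝ
  | Sum.inl 0 => 0
  | Sum.inl (s + 1) => y (Sum.inl s)
  | Sum.inr (j, m) => y (Sum.inr (j, m + 1)) +
      if j ≤ m ∧ ∃ i, m = 2 ^ i then y (Sum.inl (m - 1)) else 0

lemma step_tendsto {y : ℕ ⊕ ℕ × ℕ → ℝ} (hy : Tendsto y cofinite (nhds 0)) :
    Tendsto (step y) cofinite (nhds 0) := by
  rw [tendsto_cofinite_zero_iff] at hy ⊢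
  intro ε hε
  have hF := hy (ε / 2) (by positivity)
  set F := {p | ε / 2 ≤ |y p|} with hFdef
  refine ((hF.image (Sum.map (· + 1) (fun q => (q.1, q.2 - 1)))).union
    (hF.biUnion (t := fun p => (fun j => Sum.inr (j, p.elim (· + 1) 0)) ''
      Set.Iic (p.elim (· + 1) 0)) fun p _ => (Set.finite_Iic _).image _)).subset ?_
  rintro (s | ⟨j, m⟩) hp
  · left
    cases s with
    | zero => simp [step] at hp; linarith
    | succ s =>
      refine ⟨Sum.inl s, ?_, by simp⟩
      simp only [Set.mem_ofPred_eq, step] at hp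
      simp only [hFdef, Set.mem_ofPred_eq]
      linarith
  · by_cases h1 : ε / 2 ≤ |y (Sum.inr (j, m + 1))|
    · exact Or.inl ⟨_, h1, by simp⟩
    right
    simp only [Set.mem_ofPred_eq, step] at hp
    split_ifs at hp with h
    · obtain ⟨hjm, i, hi⟩ := h
      have hm : 1 ≤ m := hi ▸ Nat.one_le_two_pow
      refine Set.mem_biUnion (x := Sum.inl (m - 1)) ?_ ⟨j, ?_, ?_⟩
      · have := abs_add_le (y (Sum.inr (j, m + 1))) (y (Sum.inl (m - 1)))
        simp only [hFdef, Set.mem_ofPred_eq]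
        linarith
      · simp; omega
      · simp; omega
    · rw [add_zero] at hp
      linarith

lemma abs_step_le {y : ℕ ⊕ ℕ × ℕ → ℝ} {C : ℝ} (h : ∀ p, |y p| ≤ C) (p : ℕ ⊕ ℕ × ℕ) :
    |step y p| ≤ 2 * C := by
  have hC : 0 ≤ C := (abs_nonneg _).trans (h p)
  rcases p with (_ | s) | ⟨j, m⟩
  · simpa [step] using hC
  · have := h (Sum.inl s)
    simp only [step]
    linarith
  · simp only [step]
    refine (abs_add_le _ _).trans ?_
    have h1 := h (Sum.inr (j, m + 1))
    have h2 := h (Sum.inl (m - 1))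
    split_ifs
    · linarith
    · rw [abs_zero]; linarith

lemma step_nonneg {y : ℕ ⊕ ℕ × ℕ → ℝ} (h : ∀ p, 0 ≤ y p) (p : ℕ ⊕ ℕ × ℕ) : 0 ≤ step y p := by
  rcases p with (_ | s) | ⟨j, m⟩
  · exact le_rfl
  · exact h _
  · simp only [step]
    have h1 := h (Sum.inr (j, m + 1))
    have h2 := h (Sum.inl (m - 1))
    split_ifs <;> linarith

lemma step_add (y z : ℕ ⊕ ℕ × ℕ → ℝ) (p : ℕ ⊕ ℕ × ℕ) :
    step (fun q => y q + z q) p = step y p + step z p := by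
  rcases p with (_ | s) | ⟨j, m⟩
  · simp [step]
  · simp [step]
  · simp only [step]
    split_ifs <;> ring

lemma step_smul (c : ℝ) (y : ℕ ⊕ ℕ × ℕ → ℝ) (p : ℕ ⊕ ℕ × ℕ) :
    step (fun q => c * y q) p = c * step y p := by
  rcases p with (_ | s) | ⟨j, m⟩
  · simp [step]
  · simp [step]
  · simp only [step]
    split_ifs <;> ring

/-- The operator on `c₀` induced by the transition rule `step`. -/
noncomputable def shiftOp : C₀(ℕ, ℝ) →L[ℝ] C₀(ℕ, ℝ) :=
  LinearMap.mkContinuous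
    { toFun := fun x => ofTendsto (fun p => step (fun q => x (code q)) (code.symm p)) <|
        (step_tendsto (by
          have h := x.zero_at_infty'
          rw [cocompact_eq_cofinite] at h
          exact h.comp code.injective.tendsto_cofinite)).comp code.symm.injective.tendsto_cofinite
      map_add' := fun x y => by
        ext p
        exact step_add (fun q => x (code q)) (fun q => y (code q)) (code.symm p)
      map_smul' := fun c x => by
        ext p
        exact step_smul c (fun q => x (code q)) (code.symm p) }
    2 fun x => norm_le_of_forall_abs_le (by positivity) fun p =>
      abs_step_le (fun q => abs_apply_le_norm x _) _

lemma shiftOp_apply (x : C₀(ℕ, ℝ)) (p : ℕ) :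
    shiftOp x p = step (fun q => x (code q)) (code.symm p) := rfl

lemma shiftOp_code (x : C₀(ℕ, ℝ)) (q : ℕ ⊕ ℕ × ℕ) :
    shiftOp x (code q) = step (fun q => x (code q)) q := by
  rw [shiftOp_apply, Equiv.symm_apply_apply]

lemma shiftOp_pow_inl (n s : ℕ) (x : C₀(ℕ, ℝ)) :
    (shiftOp ^ n) x (code (Sum.inl s)) = if n ≤ s then x (code (Sum.inl (s - n))) else 0 := by
  induction n generalizing s with
  | zero => simp
  | succ n ih =>
    rw [pow_succ', mul_apply_eq_comp, shiftOp_code]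
    cases s with
    | zero => simp [step]
    | succ s => simp only [step, ih, add_le_add_iff_right, Nat.add_sub_add_right]

/-- Started at position `m` on the `j`-th line, after `n` steps the mass sent off at position
`2 ^ i` is present. -/
def Emitted (j m n i : ℕ) : Prop := j ≤ 2 ^ i ∧ m ≤ 2 ^ i ∧ 2 ^ i < m + n ∧ m + n ≤ 2 * 2 ^ i

lemma two_pow_lt_two_mul_two_pow {a b : ℕ} (h : 2 ^ a < 2 * 2 ^ b) : a ≤ b := by
  rw [← pow_succ'] at h
  exact Nat.lt_succ_iff.1 ((Nat.pow_lt_pow_iff_right (by norm_num)).1 h)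

lemma shiftOp_pow_inr (n j m : ℕ) (x : C₀(ℕ, ℝ)) :
    (∀ i, Emitted j m n i → (shiftOp ^ n) x (code (Sum.inr (j, m))) =
      x (code (Sum.inr (j, m + n))) + x (code (Sum.inl (2 * 2 ^ i - (m + n))))) ∧
    ((∀ i, ¬ Emitted j m n i) → (shiftOp ^ n) x (code (Sum.inr (j, m))) =
      x (code (Sum.inr (j, m + n)))) := by
  induction n generalizing m with
  | zero =>
    refine ⟨fun i hi => ?_, fun _ => by simp⟩
    obtain ⟨-, h1, h2, -⟩ := hi
    omega
  | succ n ih =>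
    rw [pow_succ', mul_apply_eq_comp, shiftOp_code]
    simp only [step, shiftOp_pow_inl]
    obtain ⟨ih1, ih2⟩ := ih (m + 1)
    rw [show m + 1 + n = m + (n + 1) by ring] at ih1 ih2
    by_cases hm : j ≤ m ∧ ∃ i, m = 2 ^ i
    · rw [if_pos hm]
      obtain ⟨hjm, i₀, hi₀⟩ := hm
      by_cases hn : n ≤ m - 1
      · have hpos : 0 < 2 ^ i₀ := by positivity
        rw [if_pos hn, ih2]
        · refine ⟨fun i hi => ?_, fun h => (h i₀ ⟨by omega, by omega, by omega, by omega⟩).elim⟩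
          obtain ⟨-, h1, h2, h3⟩ := hi
          have h4 : i ≤ i₀ := two_pow_lt_two_mul_two_pow (by omega)
          have h5 : i₀ ≤ i := two_pow_lt_two_mul_two_pow (by omega)
          obtain rfl : i = i₀ := le_antisymm h4 h5
          rw [show m - 1 - n = 2 * 2 ^ i - (m + (n + 1)) by omega]
        · rintro i ⟨-, h1, h2, h3⟩
          have h4 : i ≤ i₀ := two_pow_lt_two_mul_two_pow (by omega)
          have h5 := Nat.pow_le_pow_right (n := 2) (by norm_num) h4
          omega
      · rw [if_neg hn, add_zero]
        have key (i : ℕ) : Emitted j m (n + 1) i ↔ Emitted j (m + 1) n i := by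
          refine ⟨fun ⟨h0, h1, h2, h3⟩ => ⟨h0, ?_, by omega, by omega⟩,
            fun ⟨h0, h1, h2, h3⟩ => ⟨h0, by omega, by omega, by omega⟩⟩
          by_contra h
          omega
        simp only [key]
        exact ⟨ih1, ih2⟩
    · rw [if_neg hm, add_zero]
      have key (i : ℕ) : Emitted j m (n + 1) i ↔ Emitted j (m + 1) n i := by
        refine ⟨fun ⟨h0, h1, h2, h3⟩ => ⟨h0, ?_, by omega, by omega⟩,
          fun ⟨h0, h1, h2, h3⟩ => ⟨h0, by omega, by omega, by omega⟩⟩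
        by_contra h
        have : m = 2 ^ i := by omega
        exact hm ⟨by omega, i, this⟩
      simp only [key]
      exact ⟨ih1, ih2⟩

lemma abs_shiftOp_pow_le (n : ℕ) (x : C₀(ℕ, ℝ)) (q : ℕ ⊕ ℕ × ℕ) :
    |(shiftOp ^ n) x (code q)| ≤ 2 * ‖x‖ := by
  have h0 := norm_nonneg x
  rcases q with s | ⟨j, m⟩
  · rw [shiftOp_pow_inl]
    split_ifs
    · linarith [abs_apply_le_norm x (code (Sum.inl (s - n)))]
    · rw [abs_zero]; linarith
  · have h1 := abs_apply_le_norm x (code (Sum.inr (j, m + n)))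
    by_cases h : ∃ i, Emitted j m n i
    · obtain ⟨i, hi⟩ := h
      rw [(shiftOp_pow_inr n j m x).1 i hi]
      refine (abs_add_le _ _).trans ?_
      linarith [abs_apply_le_norm x (code (Sum.inl (2 * 2 ^ i - (m + n))))]
    · rw [(shiftOp_pow_inr n j m x).2 (not_exists.1 h)]
      linarith

lemma norm_shiftOp_pow_le (n : ℕ) : ‖shiftOp ^ n‖ ≤ 2 :=
  ContinuousLinearMap.opNorm_le_bound _ (by norm_num) fun x =>
    norm_le_of_forall_abs_le (by positivity) fun p => by
      simpa using abs_shiftOp_pow_le n x (code.symm p)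

open Classical in
/-- The times `n` at which a unit vector can have a nonzero value at a given point under
`shiftOp ^ n` are, up to a translation, a single time or doubled powers of two that are not much
larger than the translation. -/
lemma exists_abs_shiftOp_pow_unit_le (p : ℕ) : ∃ d : ℕ, ∀ q : ℕ,
    (∃ c : ℕ, ∀ n, |(shiftOp ^ n) (unit p) q| ≤ if n = c then 1 else 0) ∨
    ∃ m : ℕ, ∀ n, |(shiftOp ^ n) (unit p) q| ≤
      if ∃ i, m ≤ 2 ^ i ∧ m + n + d = 2 * 2 ^ i then 1 else 0 := by
  obtain ⟨a, rfl⟩ := code.surjective p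
  have hu (r r' : ℕ ⊕ ℕ × ℕ) : unit (code r) (code r') = if r' = r then 1 else 0 := by
    simp [unit_apply]
  rcases a with d | ⟨j', m'⟩
  · refine ⟨d, fun q => ?_⟩
    obtain ⟨b, rfl⟩ := code.surjective q
    rcases b with s | ⟨j, m⟩
    · refine Or.inl ⟨s - d, fun n => ?_⟩
      rw [shiftOp_pow_inl, hu]
      simp only [Sum.inl.injEq]
      split_ifs <;> first | omega | simp
    · refine Or.inr ⟨m, fun n => ?_⟩
      by_cases h : ∃ i, Emitted j m n i
      · obtain ⟨i, hi⟩ := h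
        rw [(shiftOp_pow_inr n j m _).1 i hi, hu, hu]
        obtain ⟨-, h1, h2, h3⟩ := hi
        simp only [Sum.inl.injEq, reduceCtorEq, if_false, zero_add]
        by_cases h4 : 2 * 2 ^ i - (m + n) = d
        · rw [if_pos h4, if_pos ⟨i, h1, by omega⟩, abs_one]
        · rw [if_neg h4, abs_zero]
          split_ifs <;> norm_num
      · rw [(shiftOp_pow_inr n j m _).2 (not_exists.1 h), hu]
        simp only [reduceCtorEq, if_false, abs_zero]
        split_ifs <;> norm_num
  · refine ⟨0, fun q => ?_⟩
    obtain ⟨b, rfl⟩ := code.surjective q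
    rcases b with s | ⟨j, m⟩
    · refine Or.inl ⟨0, fun n => ?_⟩
      rw [shiftOp_pow_inl, hu]
      simp only [reduceCtorEq, if_false, ite_self, abs_zero]
      split_ifs <;> norm_num
    · refine Or.inl ⟨m' - m, fun n => ?_⟩
      have hval : (shiftOp ^ n) (unit (code (Sum.inr (j', m')))) (code (Sum.inr (j, m))) =
          if (j, m + n) = (j', m') then 1 else 0 := by
        by_cases h : ∃ i, Emitted j m n i
        · obtain ⟨i, hi⟩ := h
          rw [(shiftOp_pow_inr n j m _).1 i hi, hu, hu]
          simp
        · rw [(shiftOp_pow_inr n j m _).2 (not_exists.1 h), hu]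
          simp
      rw [hval]
      simp only [Prod.mk.injEq]
      split_ifs <;> first | omega | simp

lemma card_filter_two_pow_le {c : ℕ} (hc : 1 ≤ c) (m d N : ℕ) (P : ℕ → Prop) [DecidablePred P]
    (hP : ∀ k, P k → ∃ i, m ≤ 2 ^ i ∧ m + c * k + d = 2 * 2 ^ i) :
    ((Finset.range N).filter P).card ≤ Nat.log 2 (c * N + d) + 1 := by
  choose! f hf using hP
  rw [← Finset.card_range (Nat.log 2 (c * N + d) + 1)]
  refine Finset.card_le_card_of_injOn f (fun k hk => ?_) fun k hk l hl hkl => ?_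
  · simp only [Finset.coe_filter, Finset.mem_range, Set.mem_ofPred_eq] at hk
    obtain ⟨h1, h2⟩ := hf k hk.2
    have h3 : c * k ≤ c * N := Nat.mul_le_mul_left c hk.1.le
    simp only [Finset.coe_range, Set.mem_Iio]
    exact Nat.lt_succ_of_le (Nat.le_log_of_pow_le (by norm_num) (by omega))
  · simp only [Finset.coe_filter, Finset.mem_range, Set.mem_ofPred_eq] at hk hl
    obtain ⟨-, h1⟩ := hf k hk.2
    obtain ⟨-, h2⟩ := hf l hl.2
    rw [hkl] at h1
    exact Nat.eq_of_mul_eq_mul_left hc (by omega)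

lemma tendsto_cesaro_shiftOp_pow_unit {m : ℕ} (hm : 1 ≤ m) (p : ℕ) :
    Tendsto (fun n : ℕ => (n : ℝ)⁻¹ • ∑ k ∈ Finset.range n, ((shiftOp ^ m) ^ k) (unit p))
      atTop (nhds 0) := by
  classical
  obtain ⟨d, hd⟩ := exists_abs_shiftOp_pow_unit_le p
  refine squeeze_zero_norm (fun N => ?_) (tendsto_natLog_div_atTop hm d)
  rw [norm_smul, norm_inv, Real.norm_natCast]
  refine mul_le_mul_of_nonneg_left ?_ (by positivity)
  refine norm_le_of_forall_abs_le (by positivity) fun q => ?_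
  rw [finset_sum_apply]
  refine (Finset.abs_sum_le_sum_abs _ _).trans ?_
  simp only [← pow_mul]
  rcases hd q with ⟨c, hc⟩ | ⟨a, ha⟩
  · refine (Finset.sum_le_sum fun k _ => hc (m * k)).trans ?_
    rw [Finset.sum_boole]
    have hcard : ((Finset.range N).filter fun k => m * k = c).card ≤ 1 :=
      Finset.card_le_one.2 fun k hk l hl => by
        simp only [Finset.mem_filter] at hk hl
        exact Nat.eq_of_mul_eq_mul_left hm (hk.2.trans hl.2.symm)
    have : (((Finset.range N).filter fun k => m * k = c).card : ℝ) ≤ 1 := by exact_mod_cast hcard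
    have hlog : (0 : ℝ) ≤ Nat.log 2 (m * N + d) := by positivity
    linarith
  · refine (Finset.sum_le_sum fun k _ => ha (m * k)).trans ?_
    rw [Finset.sum_boole]
    exact_mod_cast card_filter_two_pow_le hm a d N _ fun k hk => hk

lemma shiftOp_pow_unit_eq_one {i j : ℕ} (h : j ≤ 2 ^ i) :
    (shiftOp ^ (2 * 2 ^ i)) (unit (code (Sum.inl 0))) (code (Sum.inr (j, 0))) = 1 := by
  have hpos : 0 < 2 ^ i := by positivity
  rw [(shiftOp_pow_inr _ _ _ _).1 i ⟨h, by omega, by omega, by omega⟩]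
  simp [unit_apply]

lemma not_isCompact_closure_orbit :
    ¬ IsCompact (closure (Set.range fun n : ℕ =>
      toWeakSpace ℝ (C₀(ℕ, ℝ)) ((shiftOp ^ n) (unit (code (Sum.inl 0)))))) := by
  intro hK
  set x := unit (code (Sum.inl 0))
  obtain ⟨z, -, hz⟩ := hK.exists_mapClusterPt (f := atTop)
    (u := fun i : ℕ => toWeakSpace ℝ (C₀(ℕ, ℝ)) ((shiftOp ^ (2 * 2 ^ i)) x))
    (tendsto_principal.2 (Eventually.of_forall fun i => subset_closure ⟨_, rfl⟩))
  set w : C₀(ℕ, ℝ) := (toWeakSpace ℝ (C₀(ℕ, ℝ))).symm z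
  have hw (j : ℕ) : w (code (Sum.inr (j, 0))) = 1 := by
    have hcont : Continuous fun v : WeakSpace ℝ (C₀(ℕ, ℝ)) =>
        coord (code (Sum.inr (j, 0))) ((toWeakSpace ℝ (C₀(ℕ, ℝ))).symm v) :=
      WeakBilin.eval_continuous (topDualPairing ℝ (C₀(ℕ, ℝ))).flip (coord (code (Sum.inr (j, 0))))
    have hcl := hz.continuousAt_comp hcont.continuousAt
    have hlim : Tendsto ((fun v : WeakSpace ℝ (C₀(ℕ, ℝ)) =>
        coord (code (Sum.inr (j, 0))) ((toWeakSpace ℝ (C₀(ℕ, ℝ))).symm v)) ∘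
        fun i : ℕ => toWeakSpace ℝ (C₀(ℕ, ℝ)) ((shiftOp ^ (2 * 2 ^ i)) x)) atTop (nhds 1) := by
      refine tendsto_const_nhds.congr' ?_
      filter_upwards [eventually_ge_atTop j] with i hi
      simpa using (shiftOp_pow_unit_eq_one (hi.trans Nat.lt_two_pow_self.le)).symm
    exact eq_of_nhds_neBot (hcl.clusterPt.mono hlim)
  refine Set.infinite_range_of_injective (f := fun j : ℕ => code (Sum.inr (j, 0)))
    (fun a b h => by simpa using h) ((finite_le_abs w one_pos).subset ?_)
  rintro _ ⟨j, rfl⟩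
  simp [hw]

end NullSequence

/-- There exists a positive bounded linear operator `T` on `c₀`
(modelled as `C₀(ℕ, ℝ)`, the real null sequences with the sup norm) such that
`‖T^n‖ ≤ 4` for every `n ≥ 1`, every power `T^m` (`m ≥ 1`) is mean ergodic, and `T` is
not weakly almost periodic: some orbit is not relatively compact in the weak topology. -/
theorem exists_mean_ergodic_not_weakly_almost_periodic_on_c0 :
    ∃ T : C₀(ℕ, ℝ) →L[ℝ] C₀(ℕ, ℝ),
      (∀ n : ℕ, 1 ≤ n → ‖T ^ n‖ ≤ 4) ∧
      (∀ x : C₀(ℕ, ℝ), (∀ k : ℕ, 0 ≤ x k) → ∀ k : ℕ, 0 ≤ T x k) ∧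
      (∀ m : ℕ, 1 ≤ m → ∀ x : C₀(ℕ, ℝ), ∃ y : C₀(ℕ, ℝ),
        Tendsto (fun n : ℕ => (n : ℝ)⁻¹ • ∑ k ∈ Finset.range n, ((T ^ m) ^ k) x)
          atTop (nhds y)) ∧
      (∃ x : C₀(ℕ, ℝ),
        ¬ IsCompact (closure
          (Set.range fun n : ℕ => toWeakSpace ℝ (C₀(ℕ, ℝ)) ((T ^ n) x)))) := by
  refine ⟨NullSequence.shiftOp, fun n _ => (NullSequence.norm_shiftOp_pow_le n).trans (by norm_num),
    fun x hx k => NullSequence.step_nonneg (fun q => hx _) _, fun m hm x => ⟨0, ?_⟩,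
    _, NullSequence.not_isCompact_closure_orbit⟩
  refine NullSequence.tendsto_cesaro_zero (C := 2) (fun k => ?_)
    (NullSequence.tendsto_cesaro_shiftOp_pow_unit hm) x
  rw [← pow_mul]
  exact NullSequence.norm_shiftOp_pow_le _
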